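/- Let v be a nonconstant real analytic function on 𝕋. Then there exists a constant C = C(v) > 0 (depending only on v) such that for every E ∈ ℝ, ∫_𝕋 log|v(x) − E| dx ≥ −C. -/

import Mathlib

noncomputable section

/-- The difference quotient of an everywhere analytic function is everywhere analytic. -/
lemma analyticAt_dslope {f : ℝ → ℝ} (hf : ∀ x, AnalyticAt ℝ f x) (z x : ℝ) :
    AnalyticAt ℝ (dslope f z) x := by
  rcases eq_or_ne x z with rfl | hx
  · obtain ⟨p, hp⟩ := hf x
    exact hp.has_fpower_series_dslope_fslope.analyticAt
  · have h : (fun y ↦ (y - z)⁻¹ * (f y - f z)) =ᶠ[nhds x] dslope f z := by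
      filter_upwards [isOpen_ne.mem_nhds hx] with y hy
      rw [dslope_of_ne _ hy, slope_def_field, div_eq_inv_mul]
    refine AnalyticAt.congr ?_ h
    exact ((analyticAt_id.sub analyticAt_const).inv (sub_ne_zero.2 hx)).mul
      ((hf x).sub analyticAt_const)

lemma analyticAt_iteratedDeriv {f : ℝ → ℝ} (hf : ∀ x, AnalyticAt ℝ f x) (k : ℕ) (x : ℝ) :
    AnalyticAt ℝ (iteratedDeriv k f) x := by
  rw [iteratedDeriv_eq_iterate]
  exact (hf x).iterated_deriv k

/-- Leibniz' rule for `f x - f z = (x - z) * dslope f z x`. -/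
lemma sub_mul_iteratedDeriv_dslope {f : ℝ → ℝ} (hf : ∀ x, AnalyticAt ℝ f x) (z : ℝ) (k : ℕ) :
    ∀ x, (x - z) * iteratedDeriv (k + 1) (dslope f z) x
      + (k + 1) * iteratedDeriv k (dslope f z) x = iteratedDeriv (k + 1) f x := by
  have hd (j : ℕ) (x : ℝ) : HasDerivAt (iteratedDeriv j (dslope f z))
      (iteratedDeriv (j + 1) (dslope f z) x) x := by
    rw [iteratedDeriv_succ]
    exact (analyticAt_iteratedDeriv (analyticAt_dslope hf z) j x).differentiableAt.hasDerivAt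
  have hs (x : ℝ) : HasDerivAt (fun y ↦ y - z) 1 x := (hasDerivAt_id x).sub_const z
  induction k with
  | zero =>
    intro x
    have h : f = fun y ↦ (y - z) * iteratedDeriv 0 (dslope f z) y + f z := by
      funext y
      have := sub_smul_dslope f z y
      rw [smul_eq_mul] at this
      simp [this]
    have h' := (((hs x).mul (hd 0 x)).add_const (f z)).deriv
    rw [zero_add, iteratedDeriv_one (f := f)]
    conv_rhs => rw [h]
    erw [h']
    simp [add_comm]
  | succ k ih =>
    intro x
    have h : iteratedDeriv (k + 1) f = fun x ↦ (x - z) * iteratedDeriv (k + 1) (dslope f z) x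
      + (k + 1) * iteratedDeriv k (dslope f z) x := funext fun y ↦ (ih y).symm
    have h' := (((hs x).mul (hd (k + 1) x)).add ((hd k x).const_mul ((k : ℝ) + 1))).deriv
    rw [iteratedDeriv_succ (n := k + 1) (f := f), h]
    erw [h']
    push_cast
    ring

/-- A lower bound for the solution of `(x - z) * h' + n * h = F` in terms of one for `F`. -/
lemma div_le_of_sub_mul_deriv_add {h h' : ℝ → ℝ} {a b z c n : ℝ} (hn : 0 < n)
    (hz : z ∈ Set.Icc a b) (hd : ∀ x, HasDerivAt h (h' x) x)
    (hc : ∀ x ∈ Set.Icc a b, c ≤ (x - z) * h' x + n * h x) :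
    ∀ x ∈ Set.Icc a b, c / n ≤ h x := by
  obtain ⟨m, hm, hmin⟩ := isCompact_Icc.exists_isMinOn ⟨z, hz⟩
    (fun x _ ↦ (hd x).continuousAt.continuousWithinAt : ContinuousOn h (Set.Icc a b))
  have key : 0 ≤ (z - m) * h' m := by
    have := hmin.localize.hasFDerivWithinAt_nonneg (hd m).hasFDerivAt.hasFDerivWithinAt
      (sub_mem_posTangentConeAt_of_segment_subset ((convex_Icc a b).segment_subset hm hz))
    simpa using this
  intro x hx
  refine le_trans ?_ (hmin hx)
  rw [div_le_iff₀ hn]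
  nlinarith [hc m hm]

/-- A function whose `k`-th derivative is bounded below by `c > 0` on an interval is bounded below
in absolute value by a multiple of a product of `k` linear factors. -/
lemma exists_prod_le_abs (k : ℕ) : ∀ {f : ℝ → ℝ} {a b c : ℝ}, (∀ x, AnalyticAt ℝ f x) → a ≤ b →
    0 < c → (∀ x ∈ Set.Icc a b, c ≤ iteratedDeriv k f x) →
    ∃ z : Fin k → ℝ, (∀ i, z i ∈ Set.Icc a b) ∧
      ∀ x ∈ Set.Icc a b, c / k.factorial * ∏ i, |x - z i| ≤ |f x| := by
  induction k with
  | zero =>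
    intro f a b c _ _ _ h
    refine ⟨Fin.elim0, fun i ↦ i.elim0, fun x hx ↦ ?_⟩
    simpa using (h x hx).trans (le_abs_self _)
  | succ k ih =>
    intro f a b c hf hab hc h
    have hcont : Continuous f := continuous_iff_continuousAt.2 fun x ↦ (hf x).continuousAt
    obtain ⟨w, hw, hmin⟩ := isCompact_Icc.exists_isMinOn ⟨a, Set.left_mem_Icc.2 hab⟩
      hcont.abs.continuousOn
    have hk : (0 : ℝ) < k + 1 := by positivity
    have hg := analyticAt_dslope hf w
    have hlow : ∀ x ∈ Set.Icc a b, c / (k + 1) ≤ iteratedDeriv k (dslope f w) x := by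
      refine div_le_of_sub_mul_deriv_add (h' := iteratedDeriv (k + 1) (dslope f w)) hk hw
        (fun x ↦ ?_) fun x hx ↦ ?_
      · rw [iteratedDeriv_succ]
        exact (analyticAt_iteratedDeriv hg k x).differentiableAt.hasDerivAt
      · rw [sub_mul_iteratedDeriv_dslope hf w k x]
        exact h x hx
    obtain ⟨z, hz, hprod⟩ := ih hg hab (div_pos hc hk) hlow
    refine ⟨Fin.cons w z, Fin.cases hw hz, fun x hx ↦ ?_⟩
    have hsub : |f x - f w| ≤ |f x| := by
      by_cases h0 : f w = 0
      · simp [h0]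
      -- By minimality `f` has no zero in the interval, hence constant sign.
      have hpos : ∀ y ∈ Set.Icc a b, f y ≠ 0 := fun y hy hy0 ↦ by
        have : |f w| ≤ |f y| := hmin hy
        rw [hy0, abs_zero] at this
        exact h0 (abs_nonpos_iff.1 this)
      have hsign : 0 ≤ f x * f w := by
        by_contra! hneg
        have hmem : (0 : ℝ) ∈ Set.uIcc (f x) (f w) := by
          rcases mul_neg_iff.1 hneg with h1 | h1
          · exact Set.mem_uIcc.2 (.inr ⟨h1.2.le, h1.1.le⟩)
          · exact Set.mem_uIcc.2 (.inl ⟨h1.1.le, h1.2.le⟩)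
        obtain ⟨y, hy, hy0⟩ := intermediate_value_uIcc hcont.continuousOn hmem
        exact hpos y (Set.uIcc_subset_Icc hx hw hy) hy0
      have hle : |f w| ≤ |f x| := hmin hx
      have h1 : f w ^ 2 ≤ f x * f w := by
        rw [← abs_of_nonneg hsign, abs_mul, ← sq_abs]
        nlinarith [abs_nonneg (f w)]
      exact sq_le_sq.1 (by nlinarith)
    calc c / (k + 1).factorial * ∏ i, |x - (Fin.cons w z : Fin (k + 1) → ℝ) i|
        = |x - w| * (c / (k + 1) / k.factorial * ∏ i, |x - z i|) := by
          rw [Fin.prod_univ_succ]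
          simp only [Fin.cons_zero, Fin.cons_succ, Nat.factorial_succ]
          push_cast
          field_simp
      _ ≤ |x - w| * |dslope f w x| := by gcongr; exact hprod x hx
      _ = |f x - f w| := by rw [← abs_mul, ← smul_eq_mul, sub_smul_dslope]
      _ ≤ |f x| := hsub

lemma neg_one_le_mul_log_sub {x : ℝ} (hx : 0 ≤ x) : -1 ≤ x * Real.log x - x := by
  rcases hx.eq_or_lt with rfl | hx
  · simp
  · have := mul_le_mul_of_nonneg_left (Real.one_sub_inv_le_log_of_pos hx) hx.le
    rw [mul_sub, mul_inv_cancel₀ hx.ne'] at this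
    linarith

lemma neg_two_le_integral_log_abs_sub {a b z : ℝ} (hz : z ∈ Set.Icc a b) :
    -2 ≤ ∫ x in a..b, Real.log |x - z| := by
  simp only [Real.log_abs]
  rw [intervalIntegral.integral_comp_sub_right Real.log z, integral_log]
  have h1 := neg_one_le_mul_log_sub (sub_nonneg.2 hz.2)
  have h2 := neg_one_le_mul_log_sub (sub_nonneg.2 hz.1)
  rw [← neg_sub a z, Real.log_neg_eq_log] at h2
  linarith

lemma intervalIntegrable_log_abs {f : ℝ → ℝ} (hf : ∀ x, AnalyticAt ℝ f x) (a b : ℝ) :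
    IntervalIntegrable (fun x ↦ Real.log |f x|) MeasureTheory.volume a b := by
  have : MeromorphicOn f (Set.uIcc a b) := fun x _ ↦ (hf x).meromorphicAt
  exact this.intervalIntegrable_log_norm

/-- The integral of `log |f|` is bounded below in terms of a lower bound for a derivative. -/
lemma le_integral_log_abs_of_le_iteratedDeriv {k : ℕ} {f : ℝ → ℝ} {a b c : ℝ}
    (hf : ∀ x, AnalyticAt ℝ f x) (hab : a ≤ b) (hc : 0 < c)
    (h : ∀ x ∈ Set.Icc a b, c ≤ iteratedDeriv k f x) :
    (b - a) * Real.log (c / k.factorial) - 2 * k ≤ ∫ x in a..b, Real.log |f x| := by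
  obtain ⟨z, hz, hprod⟩ := exists_prod_le_abs k hf hab hc h
  have hint (i : Fin k) : IntervalIntegrable (fun x ↦ Real.log |x - z i|)
      MeasureTheory.volume a b :=
    intervalIntegrable_log_abs (fun x ↦ analyticAt_id.sub analyticAt_const) a b
  have hsum : IntervalIntegrable (fun x ↦ ∑ i, Real.log |x - z i|) MeasureTheory.volume a b := by
    simpa [Finset.sum_fn] using IntervalIntegrable.sum Finset.univ fun i _ ↦ hint i
  have hc' : 0 < c / k.factorial := by positivity
  calc (b - a) * Real.log (c / k.factorial) - 2 * k
      ≤ (b - a) * Real.log (c / k.factorial) + ∑ i, ∫ x in a..b, Real.log |x - z i| := by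
        have := Finset.sum_le_sum fun i (_ : i ∈ Finset.univ) ↦
          neg_two_le_integral_log_abs_sub (hz i)
        simp only [Finset.sum_const, Finset.card_univ, Fintype.card_fin, nsmul_eq_mul] at this
        linarith
    _ = ∫ x in a..b, (Real.log (c / k.factorial) + ∑ i, Real.log |x - z i|) := by
        rw [intervalIntegral.integral_add intervalIntegrable_const hsum,
          intervalIntegral.integral_finsetSum fun i _ ↦ hint i]
        simp
    _ ≤ ∫ x in a..b, Real.log |f x| := by
        refine intervalIntegral.integral_mono_ae_restrict hab (intervalIntegrable_const.add hsum)
          (intervalIntegrable_log_abs hf a b) ?_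
        have hne : ∀ᵐ x, x ∉ Set.range z :=
          (Set.finite_range z).measure_zero MeasureTheory.volume |> MeasureTheory.compl_mem_ae_iff.2
        filter_upwards [MeasureTheory.ae_restrict_of_ae hne,
          MeasureTheory.ae_restrict_mem measurableSet_Icc] with x hx hxI
        have h0 : ∀ i ∈ Finset.univ, |x - z i| ≠ 0 := fun i _ ↦
          abs_ne_zero.2 (sub_ne_zero.2 fun h ↦ hx ⟨i, h.symm⟩)
        have hp : 0 < ∏ i, |x - z i| := Finset.prod_pos fun i hi ↦ (abs_nonneg _).lt_of_ne' (h0 i hi)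
        rw [← Real.log_prod h0, ← Real.log_mul hc'.ne' hp.ne']
        exact Real.log_le_log (mul_pos hc' hp) (hprod x hxI)

/-- At every point, some derivative of positive order of a nonconstant analytic function does not
vanish. -/
lemma exists_iteratedDeriv_succ_ne_zero {v : ℝ → ℝ} (hva : ∀ x, AnalyticAt ℝ v x)
    (hvnc : ∃ a b, v a ≠ v b) (x : ℝ) : ∃ k, iteratedDeriv (k + 1) v x ≠ 0 := by
  by_contra! h
  have htop : analyticOrderAt (deriv v) x = ⊤ := by
    refine ENat.eq_top_iff_forall_ge.2 fun n ↦ ?_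
    rw [natCast_le_analyticOrderAt_iff_iteratedDeriv_eq_zero (hva x).deriv]
    intro i _
    rw [← iteratedDeriv_succ']
    exact h i
  have hzero : deriv v = 0 := AnalyticOnNhd.eq_of_eventuallyEq (z₀ := x)
    (fun y _ ↦ (hva y).deriv) (fun y _ ↦ analyticAt_const) (analyticOrderAt_eq_top.1 htop)
  obtain ⟨a, b, hne⟩ := hvnc
  exact hne (is_const_of_deriv_eq_zero (fun y ↦ (hva y).differentiableAt)
    (fun y ↦ congrFun hzero y) a b)

/-- If a derivative of positive order of `v` is bounded away from zero on an interval, then the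
integral of `log |v - E|` over it is bounded below uniformly in `E`. -/
lemma exists_le_integral_log_abs_sub {v : ℝ → ℝ} (hva : ∀ x, AnalyticAt ℝ v x) {k : ℕ}
    {a b c : ℝ} (hab : a ≤ b) (hc : 0 < c)
    (h : (∀ x ∈ Set.Icc a b, c ≤ iteratedDeriv (k + 1) v x) ∨
      ∀ x ∈ Set.Icc a b, c ≤ -iteratedDeriv (k + 1) v x) :
    ∃ C, ∀ E, C ≤ ∫ x in a..b, Real.log |v x - E| := by
  refine ⟨(b - a) * Real.log (c / (k + 1).factorial) - 2 * (k + 1 : ℕ), fun E ↦ ?_⟩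
  rcases h with h | h
  · refine le_integral_log_abs_of_le_iteratedDeriv (k := k + 1)
      (fun x ↦ (hva x).sub analyticAt_const) hab hc fun x hx ↦ ?_
    have : deriv (fun x ↦ v x - E) = deriv v := funext fun y ↦ deriv_sub_const E
    erw [iteratedDeriv_succ', this, ← iteratedDeriv_succ']
    exact h x hx
  · simp_rw [abs_sub_comm _ E]
    refine le_integral_log_abs_of_le_iteratedDeriv (k := k + 1)
      (fun x ↦ analyticAt_const.sub (hva x)) hab hc fun x hx ↦ ?_
    have : deriv (fun x ↦ E - v x) = -deriv v := funext fun y ↦ deriv_const_sub E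
    erw [iteratedDeriv_succ', this, iteratedDeriv_neg, ← iteratedDeriv_succ']
    exact h x hx

/-- Around every point there is an open set on whose subintervals the integral of `log |v - E|` is
bounded below uniformly in `E`. -/
lemma exists_isOpen_forall_le_integral {v : ℝ → ℝ} (hva : ∀ x, AnalyticAt ℝ v x)
    (hvnc : ∃ a b, v a ≠ v b) (x : ℝ) :
    ∃ U : Set ℝ, IsOpen U ∧ x ∈ U ∧ ∀ a b, a ≤ b → Set.Icc a b ⊆ U →
      ∃ C, ∀ E, C ≤ ∫ y in a..b, Real.log |v y - E| := by
  obtain ⟨k, hk⟩ := exists_iteratedDeriv_succ_ne_zero hva hvnc x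
  have hcont : Continuous (iteratedDeriv (k + 1) v) :=
    continuous_iff_continuousAt.2 fun y ↦ (analyticAt_iteratedDeriv hva (k + 1) y).continuousAt
  have hpos := abs_pos.2 hk
  rcases hk.lt_or_gt with hlt | hgt
  · refine ⟨{y | |iteratedDeriv (k + 1) v x| / 2 < -iteratedDeriv (k + 1) v y},
      isOpen_lt continuous_const hcont.neg, ?_, fun a b hab hU ↦
      exists_le_integral_log_abs_sub hva hab (half_pos hpos) (.inr fun y hy ↦ (hU hy).le)⟩
    change |iteratedDeriv (k + 1) v x| / 2 < -iteratedDeriv (k + 1) v x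
    rw [← abs_of_neg hlt]
    exact half_lt_self hpos
  · refine ⟨{y | |iteratedDeriv (k + 1) v x| / 2 < iteratedDeriv (k + 1) v y},
      isOpen_lt continuous_const hcont, ?_, fun a b hab hU ↦
      exists_le_integral_log_abs_sub hva hab (half_pos hpos) (.inl fun y hy ↦ (hU hy).le)⟩
    change |iteratedDeriv (k + 1) v x| / 2 < iteratedDeriv (k + 1) v x
    conv_rhs => rw [← abs_of_pos hgt]
    exact half_lt_self hpos

/-- **Lemma.** For a nonconstant real analytic `v` on `𝕋` there is `C = C(v) > 0` such
that `∫_𝕋 log|v(x) − E| dx ≥ −C` for every `E ∈ ℝ`. -/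
theorem log_integral_lower_bound (v : ℝ → ℝ)
    (hva : ∀ x : ℝ, AnalyticAt ℝ v x)
    (hvper : ∀ x : ℝ, v (x + 1) = v x)
    (hvnc : ∃ a b : ℝ, v a ≠ v b) :
    ∃ C > (0 : ℝ), ∀ E : ℝ, -C ≤ ∫ x in (0 : ℝ)..1, Real.log |v x - E| := by
  choose U hUo hUx hU using exists_isOpen_forall_le_integral hva hvnc
  obtain ⟨t, ht0, htm, ⟨m, hm⟩, hcov⟩ := exists_monotone_Icc_subset_open_cover_Icc
    (zero_le_one (α := ℝ)) (c := fun x ↦ Subtype.val ⁻¹' U x)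
    (fun x ↦ (hUo x).preimage continuous_subtype_val)
    (fun x _ ↦ Set.mem_iUnion.2 ⟨x, hUx x⟩)
  have hpiece (n : ℕ) : ∃ C, ∀ E, C ≤ ∫ y in (t n : ℝ)..t (n + 1), Real.log |v y - E| := by
    obtain ⟨x, hx⟩ := hcov n
    refine hU x _ _ (htm n.le_succ) fun y hy ↦ ?_
    exact @hx ⟨y, (t n).2.1.trans hy.1, hy.2.trans (t (n + 1)).2.2⟩ ⟨hy.1, hy.2⟩
  choose C hC using hpiece
  refine ⟨|∑ n ∈ Finset.range m, C n| + 1, by positivity, fun E ↦ ?_⟩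
  have hadj := intervalIntegral.sum_integral_adjacent_intervals (a := fun n ↦ (t n : ℝ)) (n := m)
    fun n _ ↦ intervalIntegrable_log_abs
      (fun x ↦ (hva x).sub (analyticAt_const (v := E))) (t n) (t (n + 1))
  have hle := Finset.sum_le_sum fun n (_ : n ∈ Finset.range m) ↦ hC n E
  simp only [Pi.sub_apply] at hadj
  rw [hadj, ht0, hm m le_rfl] at hle
  linarith [neg_abs_le (∑ n ∈ Finset.range m, C n)]

end
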